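/- Let u₀, u₁ : ℝ × ℝ → ℝ be C^∞ functions of (t,x). Set Δ₁ = u₁_t + u₀ u₁_x + u₁ u₀_x + u₁_{xxx} − u₀_{xx}. Then the pointwise identity Δ₁ = ∂_t[ t u₁ u₀_x + (t u₀ − x) u₁_x ] + ∂_x[ u₁_{xx} − t u₁ u₀_t − u₀_x − (t u₀ − x) u₁_t ] holds. -/

import Mathlib

noncomputable def pt (f : ℝ × ℝ → ℝ) : ℝ × ℝ → ℝ := fun p => deriv (fun s => f (s, p.2)) p.1
noncomputable def px (f : ℝ × ℝ → ℝ) : ℝ × ℝ → ℝ := fun p => deriv (fun y => f (p.1, y)) p.2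

theorem hasDerivAt_slice_fst {f : ℝ × ℝ → ℝ} (hf : Differentiable ℝ f) (p : ℝ × ℝ) :
    HasDerivAt (fun s => f (s, p.2)) (fderiv ℝ f p (1, 0)) p.1 :=
  (hf p).hasFDerivAt.comp_hasDerivAt p.1 ((hasDerivAt_id p.1).prodMk (hasDerivAt_const p.1 p.2))

theorem hasDerivAt_slice_snd {f : ℝ × ℝ → ℝ} (hf : Differentiable ℝ f) (p : ℝ × ℝ) :
    HasDerivAt (fun y => f (p.1, y)) (fderiv ℝ f p (0, 1)) p.2 :=
  (hf p).hasFDerivAt.comp_hasDerivAt p.2 ((hasDerivAt_const p.2 p.1).prodMk (hasDerivAt_id p.2))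

theorem pt_eq_fderiv {f : ℝ × ℝ → ℝ} (hf : Differentiable ℝ f) :
    pt f = fun p => fderiv ℝ f p (1, 0) :=
  funext fun p => (hasDerivAt_slice_fst hf p).deriv

theorem px_eq_fderiv {f : ℝ × ℝ → ℝ} (hf : Differentiable ℝ f) :
    px f = fun p => fderiv ℝ f p (0, 1) :=
  funext fun p => (hasDerivAt_slice_snd hf p).deriv

theorem hasDerivAt_pt {f : ℝ × ℝ → ℝ} (hf : Differentiable ℝ f) (p : ℝ × ℝ) :
    HasDerivAt (fun s => f (s, p.2)) (pt f p) p.1 :=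
  (hasDerivAt_slice_fst hf p).differentiableAt.hasDerivAt

theorem hasDerivAt_px {f : ℝ × ℝ → ℝ} (hf : Differentiable ℝ f) (p : ℝ × ℝ) :
    HasDerivAt (fun y => f (p.1, y)) (px f p) p.2 :=
  (hasDerivAt_slice_snd hf p).differentiableAt.hasDerivAt

theorem ContDiff.differentiable_of_smooth {f : ℝ × ℝ → ℝ} (hf : ContDiff ℝ (⊤ : ℕ∞) f) :
    Differentiable ℝ f :=
  hf.differentiable (by simp)

theorem contDiff_pt {f : ℝ × ℝ → ℝ} (hf : ContDiff ℝ (⊤ : ℕ∞) f) :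
    ContDiff ℝ (⊤ : ℕ∞) (pt f) := by
  rw [pt_eq_fderiv hf.differentiable_of_smooth]
  exact (hf.fderiv_right (m := (⊤ : ℕ∞)) (by simp)).clm_apply contDiff_const

theorem contDiff_px {f : ℝ × ℝ → ℝ} (hf : ContDiff ℝ (⊤ : ℕ∞) f) :
    ContDiff ℝ (⊤ : ℕ∞) (px f) := by
  rw [px_eq_fderiv hf.differentiable_of_smooth]
  exact (hf.fderiv_right (m := (⊤ : ℕ∞)) (by simp)).clm_apply contDiff_const

theorem pt_px_comm {f : ℝ × ℝ → ℝ} (hf : ContDiff ℝ (⊤ : ℕ∞) f) (p : ℝ × ℝ) :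
    pt (px f) p = px (pt f) p := by
  have hd : DifferentiableAt ℝ (fderiv ℝ f) p :=
    (hf.fderiv_right (m := (⊤ : ℕ∞)) (by simp)).differentiable (by simp) p
  have hsymm : IsSymmSndFDerivAt ℝ f p := by
    refine hf.contDiffAt.isSymmSndFDerivAt ?_
    rw [minSmoothness_of_isRCLikeNormedField]
    exact WithTop.coe_le_coe.2 le_top
  rw [pt_eq_fderiv (contDiff_px hf).differentiable_of_smooth,
    px_eq_fderiv (contDiff_pt hf).differentiable_of_smooth,
    pt_eq_fderiv hf.differentiable_of_smooth, px_eq_fderiv hf.differentiable_of_smooth]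
  simp only [fderiv_clm_apply hd (differentiableAt_const _)]
  simpa using hsymm.eq (1, 0) (0, 1)

theorem stmt6 (u₀ u₁ : ℝ × ℝ → ℝ) (hu₀ : ContDiff ℝ (⊤ : ℕ∞) u₀) (hu₁ : ContDiff ℝ (⊤ : ℕ∞) u₁) :
    ∀ p : ℝ × ℝ,
      pt u₁ p + u₀ p * px u₁ p + u₁ p * px u₀ p + px (px (px u₁)) p - px (px u₀) p =
      pt (fun q => q.1 * u₁ q * px u₀ q + (q.1 * u₀ q - q.2) * px u₁ q) p
      + px (fun q => px (px u₁) q - q.1 * u₁ q * pt u₀ q - px u₀ q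
          - (q.1 * u₀ q - q.2) * pt u₁ q) p := by
  intro p
  have ht {f : ℝ × ℝ → ℝ} (hf : ContDiff ℝ (⊤ : ℕ∞) f) :=
    hasDerivAt_pt hf.differentiable_of_smooth p
  have hx {f : ℝ × ℝ → ℝ} (hf : ContDiff ℝ (⊤ : ℕ∞) f) :=
    hasDerivAt_px hf.differentiable_of_smooth p
  have density := ((((hasDerivAt_id p.1).mul (ht hu₁)).mul (ht (contDiff_px hu₀))).add
    ((((hasDerivAt_id p.1).mul (ht hu₀)).sub_const p.2).mul (ht (contDiff_px hu₁)))).deriv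
  have flux := ((((hx (contDiff_px (contDiff_px hu₁))).sub (((hx hu₁).const_mul p.1).mul
    (hx (contDiff_pt hu₀)))).sub (hx (contDiff_px hu₀))).sub
    ((((hx hu₀).const_mul p.1).sub (hasDerivAt_id p.2)).mul (hx (contDiff_pt hu₁)))).deriv
  have hdensity : pt (fun q => q.1 * u₁ q * px u₀ q + (q.1 * u₀ q - q.2) * px u₁ q) p = _ :=
    density
  have hflux : px (fun q => px (px u₁) q - q.1 * u₁ q * pt u₀ q - px u₀ q
      - (q.1 * u₀ q - q.2) * pt u₁ q) p = _ := flux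
  rw [hdensity, hflux, pt_px_comm hu₀, pt_px_comm hu₁]
  simp only [Pi.mul_apply, Pi.sub_apply, id_eq, Prod.mk.eta]
  ring
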